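/- Abstract one-step alternating minimization contraction: let H : X × Y → ℝ where X, Y are real Hilbert spaces, H is σ-strongly convex (jointly), and the partial functionals x ↦ H(x,y) and y ↦ H(x,y) have L₁- and L₂-Lipschitz gradients respectively (L₁, L₂ ≥ σ > 0). If (x*, y*) minimizes H, x⁺ minimizes H(·, y) and y⁺ minimizes H(x⁺, ·), then H(x⁺, y⁺) - H(x*, y*) ≤ (1 - σ/L₁)(1 - σ/L₂)(H(x, y) - H(x*, y*)). -/

import Mathlib

theorem aux_descent {E : Type*} [NormedAddCommGroup E] [InnerProductSpace ℝ E] [CompleteSpace E]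
    (f : E → ℝ) (L : ℝ) (hf : Differentiable ℝ f)
    (hg : ∀ a b : E, ‖gradient f a - gradient f b‖ ≤ L * ‖a - b‖) (z d : E) :
    f (z + d) ≤ f z + inner ℝ (gradient f z) d + L / 2 * ‖d‖ ^ 2 := by
  set φ : ℝ → ℝ := fun t => f (z + t • d) - t * inner ℝ (gradient f z) d - L / 2 * t ^ 2 * ‖d‖ ^ 2
    with hφ
  have hder : ∀ t : ℝ, HasDerivAt φ (inner ℝ (gradient f (z + t • d)) d
      - inner ℝ (gradient f z) d - L * t * ‖d‖ ^ 2) t := by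
    intro t
    have h1 : HasDerivAt (fun t : ℝ => z + t • d) d t := by
      simpa using ((hasDerivAt_id t).smul_const d).const_add z
    have h2 := (hf (z + t • d)).hasFDerivAt.comp_hasDerivAt t h1
    have h3 : HasDerivAt (fun t : ℝ => f (z + t • d)) (inner ℝ (gradient f (z + t • d)) d) t := by
      have e : inner ℝ (gradient f (z + t • d)) d = fderiv ℝ f (z + t • d) d := by simp
      rw [e]
      exact h2
    have h4 : HasDerivAt (fun t : ℝ => t * inner ℝ (gradient f z) d)
        (inner ℝ (gradient f z) d) t := by
      simpa using (hasDerivAt_id t).mul_const (inner ℝ (gradient f z) d)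
    have h5 : HasDerivAt (fun t : ℝ => L / 2 * t ^ 2 * ‖d‖ ^ 2) (L * t * ‖d‖ ^ 2) t := by
      have := ((hasDerivAt_pow 2 t).const_mul (L / 2)).mul_const (‖d‖ ^ 2)
      have e : L * t * ‖d‖ ^ 2 = L / 2 * (((2 : ℕ) : ℝ) * t ^ (2 - 1)) * ‖d‖ ^ 2 := by
        push_cast; ring
      rw [e]
      exact this
    exact (h3.sub h4).sub h5
  have hanti : AntitoneOn φ (Set.Ici 0) := by
    apply antitoneOn_of_deriv_nonpos (convex_Ici 0)
    · exact fun t _ => (hder t).continuousAt.continuousWithinAt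
    · exact fun t _ => (hder t).differentiableAt.differentiableWithinAt
    · intro t ht
      rw [interior_Ici] at ht
      have ht' : 0 < t := ht
      rw [(hder t).deriv, ← inner_sub_left]
      have h1 := real_inner_le_norm (gradient f (z + t • d) - gradient f z) d
      have h2 := hg (z + t • d) z
      rw [add_sub_cancel_left, norm_smul, Real.norm_of_nonneg ht'.le] at h2
      have h3 := mul_le_mul_of_nonneg_right h2 (norm_nonneg d)
      nlinarith
  have := hanti (Set.mem_Ici.2 le_rfl) (Set.mem_Ici.2 zero_le_one) zero_le_one
  simp only [hφ, zero_smul, one_smul, add_zero] at this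
  linarith

theorem aux_grad_zero {E : Type*} [NormedAddCommGroup E] [InnerProductSpace ℝ E] [CompleteSpace E]
    (f : E → ℝ) (z : E) (h : ∀ a, f z ≤ f a) : gradient f z = 0 := by
  have : IsLocalMin f z := Filter.Eventually.of_forall h
  simp [gradient, this.fderiv_eq_zero]

theorem aux_cut {X Y : Type*} [NormedAddCommGroup X] [InnerProductSpace ℝ X] [CompleteSpace X]
    [NormedAddCommGroup Y] [InnerProductSpace ℝ Y] [CompleteSpace Y]
    (H : X × Y → ℝ) (σ : ℝ) (hd : Differentiable ℝ H)
    (hsc : ∀ p q : X × Y, ∀ a b : ℝ, 0 ≤ a → 0 ≤ b → a + b = 1 →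
      H (a • p + b • q) ≤ a * H p + b * H q
        - σ / 2 * (a * b) * (‖p.1 - q.1‖ ^ 2 + ‖p.2 - q.2‖ ^ 2)) (x x' : X) (y y' : Y) :
    H (x, y) + inner ℝ (gradient (fun x => H (x, y)) x) (x' - x)
      + inner ℝ (gradient (fun y => H (x, y)) y) (y' - y)
      + σ / 2 * (‖x' - x‖ ^ 2 + ‖y' - y‖ ^ 2) ≤ H (x', y') := by
  set D := fderiv ℝ H (x, y) with hD
  have hH : HasFDerivAt H D (x, y) := (hd (x, y)).hasFDerivAt
  have e1 : inner ℝ (gradient (fun x => H (x, y)) x) (x' - x) = D (x' - x, 0) := by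
    have h1 : HasFDerivAt (fun x : X => H (x, y)) (D.comp (ContinuousLinearMap.inl ℝ X Y)) x :=
      hH.comp x (hasFDerivAt_prodMk_left x y)
    simp [gradient, h1.fderiv]
  have e2 : inner ℝ (gradient (fun y => H (x, y)) y) (y' - y) = D (0, y' - y) := by
    have h1 : HasFDerivAt (fun y : Y => H (x, y)) (D.comp (ContinuousLinearMap.inr ℝ X Y)) y :=
      hH.comp y (hasFDerivAt_prodMk_right x y)
    simp [gradient, h1.fderiv]
  have e3 : D (x' - x, 0) + D (0, y' - y) = D (x' - x, y' - y) := by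
    rw [← map_add]; simp
  set N := ‖x' - x‖ ^ 2 + ‖y' - y‖ ^ 2 with hN
  set φ : ℝ → ℝ := fun t => H ((x, y) + t • (x' - x, y' - y)) with hφ
  have h1 : HasDerivAt (fun t : ℝ => (x, y) + t • (x' - x, y' - y)) (x' - x, y' - y) 0 := by
    simpa using ((hasDerivAt_id (0 : ℝ)).smul_const (x' - x, y' - y)).const_add (x, y)
  have h2 : HasDerivAt φ (D (x' - x, y' - y)) 0 := by
    have hH' : HasFDerivAt H D ((x, y) + (0 : ℝ) • (x' - x, y' - y)) := by simpa using hH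
    exact hH'.comp_hasDerivAt (0 : ℝ) h1
  have h3 := h2.tendsto_slope_zero_right
  have h4 : Filter.Tendsto (fun t : ℝ => H (x', y') - H (x, y) - σ / 2 * (1 - t) * N)
      (nhdsWithin 0 (Set.Ioi 0)) (nhds (H (x', y') - H (x, y) - σ / 2 * (1 - 0) * N)) := by
    apply Filter.Tendsto.mono_left _ nhdsWithin_le_nhds
    apply Continuous.tendsto
    fun_prop
  have h5 := le_of_tendsto_of_tendsto h3 h4 (by
    have : Set.Ioo (0 : ℝ) 1 ∈ nhdsWithin (0 : ℝ) (Set.Ioi 0) := Ioo_mem_nhdsGT one_pos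
    filter_upwards [this] with t ht
    have hs := hsc (x', y') (x, y) t (1 - t) ht.1.le (by linarith [ht.2]) (by ring)
    have : t • (x', y') + (1 - t) • (x, y) = (x, y) + t • (x' - x, y' - y) := by
      ext <;> simp <;> module
    rw [this] at hs
    simp only [hφ, zero_add, smul_eq_mul, zero_smul, add_zero]
    rw [inv_mul_le_iff₀ ht.1]
    simp only [← hN] at hs
    linarith)
  rw [e1, e2]
  linarith

theorem aux_quad {E : Type*} [NormedAddCommGroup E] [InnerProductSpace ℝ E]
    (u : E) (l C : ℝ) (hl : 0 < l) (h : ∀ d : E, inner ℝ u d - l / 2 * ‖d‖ ^ 2 ≤ C) :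
    ‖u‖ ^ 2 ≤ 2 * l * C := by
  have := h (l⁻¹ • u)
  rw [inner_smul_right, real_inner_self_eq_norm_sq, norm_smul, Real.norm_of_nonneg
    (inv_pos.2 hl).le] at this
  have h2 : l⁻¹ * ‖u‖ ^ 2 - l / 2 * (l⁻¹ * ‖u‖) ^ 2 = ‖u‖ ^ 2 / (2 * l) := by field_simp; ring
  rw [h2, div_le_iff₀ (by positivity)] at this
  linarith

theorem aux_alg (σ p q H0 H1 xx hx hh yy yv vv gy gv gg : ℝ) (hσ : 0 < σ) (hp : 0 < p) (hq : 0 < q)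
    (E21 : hh - 2 * σ * hx + σ ^ 2 * xx ≤ 2 * p * (hx - σ / 2 * (xx + vv) - H1))
    (E20 : σ ^ 2 * xx ≤ 2 * p * (gy - σ / 2 * (xx + yy) - H0))
    (E01X : hh ≤ 2 * p * (H0 - H1 - σ / 2 * (yy - 2 * yv + vv)))
    (E01Y : σ ^ 2 * (yy - 2 * yv + vv) - 2 * σ * (gy - gv) + gg
      ≤ 2 * q * (H0 - H1 - σ / 2 * (yy - 2 * yv + vv)))
    (S1 : ∀ k : ℝ, 0 ≤ hh - 2 * k * hx + k ^ 2 * xx)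
    (S2 : ∀ k m : ℝ, 0 ≤ gg + k ^ 2 * yy + m ^ 2 * vv - 2 * k * gy + 2 * m * gv - 2 * k * m * yv)
    (S3 : ∀ k : ℝ, 0 ≤ vv - 2 * k * yv + k ^ 2 * yy) :
    H1 ≤ (1 - σ / (p + σ)) * (1 - σ / (q + σ)) * H0 := by
  set T := p + q + σ with hT
  have hTp : 0 < T := by positivity
  set ρ := p * q / ((p + σ) * (q + σ)) with hρ
  have h1 := mul_nonneg (show 0 ≤ σ / ((p + σ) * p) by positivity) (sub_nonneg.2 E21)
  have h2 := mul_nonneg (show 0 ≤ σ / ((p + σ) * (q + σ)) by positivity) (sub_nonneg.2 E20)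
  have h3 := mul_nonneg (show 0 ≤ q / ((p + σ) * T) by positivity) (sub_nonneg.2 E01X)
  have h4 := mul_nonneg (show 0 ≤ p / (T * q) by positivity) (sub_nonneg.2 E01Y)
  have h5 := mul_nonneg (show 0 ≤ σ / ((p + σ) * p) + q / ((p + σ) * T) by positivity)
    (S1 (σ * T / (q + σ)))
  have h6 := mul_nonneg (show 0 ≤ p / (T * q) by positivity)
    (S2 (σ + σ * T * q / ((p + σ) * (q + σ))) σ)
  have h7 := mul_nonneg hσ.le (S3 ρ)
  have key : 2 * ((1 - σ / (p + σ)) * (1 - σ / (q + σ)) * H0 - H1) =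
    σ / ((p + σ) * p) * (2 * p * (hx - σ / 2 * (xx + vv) - H1) - (hh - 2 * σ * hx + σ ^ 2 * xx))
    + σ / ((p + σ) * (q + σ)) * (2 * p * (gy - σ / 2 * (xx + yy) - H0) - σ ^ 2 * xx)
    + q / ((p + σ) * T) * (2 * p * (H0 - H1 - σ / 2 * (yy - 2 * yv + vv)) - hh)
    + p / (T * q) * (2 * q * (H0 - H1 - σ / 2 * (yy - 2 * yv + vv)) -
        (σ ^ 2 * (yy - 2 * yv + vv) - 2 * σ * (gy - gv) + gg))
    + (σ / ((p + σ) * p) + q / ((p + σ) * T)) *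
        (hh - 2 * (σ * T / (q + σ)) * hx + (σ * T / (q + σ)) ^ 2 * xx)
    + p / (T * q) * (gg + (σ + σ * T * q / ((p + σ) * (q + σ))) ^ 2 * yy + σ ^ 2 * vv
        - 2 * (σ + σ * T * q / ((p + σ) * (q + σ))) * gy + 2 * σ * gv
        - 2 * (σ + σ * T * q / ((p + σ) * (q + σ))) * σ * yv)
    + σ * (vv - 2 * ρ * yv + ρ ^ 2 * yy) := by
    simp only [hρ]
    have hT' : p + q + σ ≠ 0 := by positivity
    simp only [hT]
    field_simp
    ring
  linarith

theorem aux_strict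
    {X Y : Type*} [NormedAddCommGroup X] [InnerProductSpace ℝ X] [CompleteSpace X]
    [NormedAddCommGroup Y] [InnerProductSpace ℝ Y] [CompleteSpace Y]
    (H : X × Y → ℝ) (σ L₁ L₂ : ℝ)
    (hσ : 0 < σ) (hL₁ : σ < L₁) (hL₂ : σ < L₂)
    (hd : Differentiable ℝ H)
    (hsc : ∀ p q : X × Y, ∀ a b : ℝ, 0 ≤ a → 0 ≤ b → a + b = 1 →
      H (a • p + b • q) ≤ a * H p + b * H q
        - σ / 2 * (a * b) * (‖p.1 - q.1‖ ^ 2 + ‖p.2 - q.2‖ ^ 2))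
    (hgrad₁ : ∀ (y : Y) (x₁ x₂ : X),
      ‖gradient (fun x => H (x, y)) x₁ - gradient (fun x => H (x, y)) x₂‖ ≤ L₁ * ‖x₁ - x₂‖)
    (hgrad₂ : ∀ (x : X) (y₁ y₂ : Y),
      ‖gradient (fun y => H (x, y)) y₁ - gradient (fun y => H (x, y)) y₂‖ ≤ L₂ * ‖y₁ - y₂‖)
    (xs : X) (ys : Y) (hmin : ∀ p : X × Y, H (xs, ys) ≤ H p)
    (y : Y) (xp : X) (yp : Y)
    (hxp : ∀ x' : X, H (xp, y) ≤ H (x', y))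
    (hyp : ∀ y' : Y, H (xp, yp) ≤ H (xp, y')) :
    H (xp, yp) - H (xs, ys) ≤ (1 - σ / L₁) * (1 - σ / L₂) * (H (xp, y) - H (xs, ys)) := by
  have dx : ∀ b : Y, Differentiable ℝ (fun a : X => H (a, b)) := fun b => by fun_prop
  have dy : ∀ a : X, Differentiable ℝ (fun b : Y => H (a, b)) := fun a => by fun_prop
  have z1 := aux_grad_zero (fun a => H (a, ys)) xs (fun a => hmin (a, ys))
  have z2 := aux_grad_zero (fun a => H (a, y)) xp hxp
  have z3 := aux_grad_zero (fun b => H (xp, b)) yp hyp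
  set h := gradient (fun a => H (a, yp)) xp with hh
  set g := gradient (fun b => H (xp, b)) y with hg
  -- cuts
  have c1 : ∀ a b, H (xp, yp) + inner ℝ h (a - xp)
      + σ / 2 * (‖a - xp‖ ^ 2 + ‖b - yp‖ ^ 2) ≤ H (a, b) := by
    intro a b
    have := aux_cut H σ hd hsc xp a yp b
    rw [z3, inner_zero_left] at this
    linarith
  have c0 : ∀ a b, H (xp, y) + inner ℝ g (b - y)
      + σ / 2 * (‖a - xp‖ ^ 2 + ‖b - y‖ ^ 2) ≤ H (a, b) := by
    intro a b
    have := aux_cut H σ hd hsc xp a y b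
    rw [z2, inner_zero_left] at this
    linarith
  -- descent
  have d2 : ∀ d, H (xs + d, ys) ≤ H (xs, ys) + L₁ / 2 * ‖d‖ ^ 2 := by
    intro d
    have := aux_descent (fun a => H (a, ys)) L₁ (dx ys) (hgrad₁ ys) xs d
    rw [z1, inner_zero_left] at this
    linarith
  have d0 : ∀ d, H (xp + d, y) ≤ H (xp, y) + L₁ / 2 * ‖d‖ ^ 2 := by
    intro d
    have := aux_descent (fun a => H (a, y)) L₁ (dx y) (hgrad₁ y) xp d
    rw [z2, inner_zero_left] at this
    linarith
  have d0' : ∀ d, H (xp, y + d) ≤ H (xp, y) + inner ℝ g d + L₂ / 2 * ‖d‖ ^ 2 := fun d =>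
    aux_descent (fun b => H (xp, b)) L₂ (dy xp) (hgrad₂ xp) y d
  clear_value h g
  obtain ⟨u, rfl⟩ : ∃ u, xp = xs + u := ⟨xp - xs, by abel⟩
  obtain ⟨v, rfl⟩ : ∃ v, yp = ys + v := ⟨yp - ys, by abel⟩
  obtain ⟨w, rfl⟩ : ∃ w, y = ys + w := ⟨y - ys, by abel⟩
  have E21 := aux_quad (h - σ • u) (L₁ - σ)
    (inner ℝ h u - σ / 2 * (‖u‖ ^ 2 + ‖v‖ ^ 2) - (H (xs + u, ys + v) - H (xs, ys)))
    (by linarith) (by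
      intro d
      have k1 := c1 (xs + d) ys
      have k2 := d2 d
      rw [show xs + d - (xs + u) = d - u by abel, show ys - (ys + v) = -v by abel, norm_neg,
        norm_sub_sq_real, inner_sub_right] at k1
      rw [inner_sub_left, real_inner_smul_left, real_inner_comm]
      rw [real_inner_comm] at k1
      simp only [real_inner_comm] at *
      linarith)
  have E20 := aux_quad (-(σ • u)) (L₁ - σ)
    (inner ℝ g w - σ / 2 * (‖u‖ ^ 2 + ‖w‖ ^ 2) - (H (xs + u, ys + w) - H (xs, ys)))
    (by linarith) (by
      intro d
      have k1 := c0 (xs + d) ys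
      have k2 := d2 d
      rw [show xs + d - (xs + u) = d - u by abel, show ys - (ys + w) = -w by abel, norm_neg,
        norm_sub_sq_real, inner_neg_right] at k1
      rw [inner_neg_left, real_inner_smul_left]
      simp only [real_inner_comm] at *
      linarith)
  have E01X := aux_quad h (L₁ - σ)
    (H (xs + u, ys + w) - H (xs, ys) - (H (xs + u, ys + v) - H (xs, ys)) - σ / 2 * ‖w - v‖ ^ 2)
    (by linarith) (by
      intro d
      have k1 := c1 (xs + u + d) (ys + w)
      have k2 := d0 d
      rw [show xs + u + d - (xs + u) = d by abel, show ys + w - (ys + v) = w - v by abel] at k1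
      linarith)
  have E01Y := aux_quad (σ • (w - v) - g) (L₂ - σ)
    (H (xs + u, ys + w) - H (xs, ys) - (H (xs + u, ys + v) - H (xs, ys)) - σ / 2 * ‖w - v‖ ^ 2)
    (by linarith) (by
      intro d
      have k1 := c1 (xs + u) (ys + w + d)
      have k2 := d0' d
      rw [sub_self, inner_zero_right, norm_zero,
        show ys + w + d - (ys + v) = (w - v) + d by abel, norm_add_sq_real] at k1
      rw [inner_sub_left, real_inner_smul_left]
      linarith)
  have S1 : ∀ k : ℝ, 0 ≤ ‖h‖ ^ 2 - 2 * k * inner ℝ h u + k ^ 2 * ‖u‖ ^ 2 := by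
    intro k
    have := sq_nonneg ‖h - k • u‖
    rw [norm_sub_sq_real, real_inner_smul_right, norm_smul, mul_pow, Real.norm_eq_abs,
      sq_abs] at this
    linarith
  have S3 : ∀ k : ℝ, 0 ≤ ‖v‖ ^ 2 - 2 * k * inner ℝ w v + k ^ 2 * ‖w‖ ^ 2 := by
    intro k
    have := sq_nonneg ‖v - k • w‖
    rw [norm_sub_sq_real, real_inner_smul_right, norm_smul, mul_pow, Real.norm_eq_abs,
      sq_abs, real_inner_comm] at this
    linarith
  have S2 : ∀ k m : ℝ, 0 ≤ ‖g‖ ^ 2 + k ^ 2 * ‖w‖ ^ 2 + m ^ 2 * ‖v‖ ^ 2 - 2 * k * inner ℝ g w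
      + 2 * m * inner ℝ g v - 2 * k * m * inner ℝ w v := by
    intro k m
    have := sq_nonneg ‖g - (k • w - m • v)‖
    rw [norm_sub_sq_real, norm_sub_sq_real (k • w), inner_sub_right, real_inner_smul_right,
      real_inner_smul_right, real_inner_smul_right, real_inner_smul_left, norm_smul, norm_smul,
      mul_pow, mul_pow, Real.norm_eq_abs, Real.norm_eq_abs, sq_abs, sq_abs] at this
    linarith
  rw [norm_sub_sq_real, real_inner_smul_right, norm_smul, mul_pow, Real.norm_eq_abs,
    sq_abs] at E21
  rw [norm_neg, norm_smul, mul_pow, Real.norm_eq_abs, sq_abs] at E20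
  rw [norm_sub_sq_real] at E01X
  rw [norm_sub_sq_real, real_inner_smul_left, norm_smul, mul_pow, Real.norm_eq_abs,
    sq_abs, norm_sub_sq_real, inner_sub_left, real_inner_comm g w, real_inner_comm g v] at E01Y
  have := aux_alg σ (L₁ - σ) (L₂ - σ) (H (xs + u, ys + w) - H (xs, ys))
    (H (xs + u, ys + v) - H (xs, ys)) (‖u‖ ^ 2) (inner ℝ h u) (‖h‖ ^ 2) (‖w‖ ^ 2) (inner ℝ w v)
    (‖v‖ ^ 2) (inner ℝ g w) (inner ℝ g v) (‖g‖ ^ 2) hσ (by linarith) (by linarith)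
    (by linarith) (by linarith) (by linarith) (by linarith) S1 S2 S3
  simpa using this


theorem stmt_12
    {X Y : Type*} [NormedAddCommGroup X] [InnerProductSpace ℝ X] [FiniteDimensional ℝ X]
    [NormedAddCommGroup Y] [InnerProductSpace ℝ Y] [FiniteDimensional ℝ Y]
    (H : X × Y → ℝ) (σ L₁ L₂ : ℝ)
    (hσ : 0 < σ) (hL₁ : σ ≤ L₁) (hL₂ : σ ≤ L₂)
    (hC2 : ContDiff ℝ 2 H)
    (hsc : ∀ p q : X × Y, ∀ a b : ℝ, 0 ≤ a → 0 ≤ b → a + b = 1 →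
      H (a • p + b • q) ≤ a * H p + b * H q
        - σ / 2 * (a * b) * (‖p.1 - q.1‖ ^ 2 + ‖p.2 - q.2‖ ^ 2))
    (hgrad₁ : ∀ (y : Y) (x₁ x₂ : X),
      ‖gradient (fun x => H (x, y)) x₁ - gradient (fun x => H (x, y)) x₂‖ ≤ L₁ * ‖x₁ - x₂‖)
    (hgrad₂ : ∀ (x : X) (y₁ y₂ : Y),
      ‖gradient (fun y => H (x, y)) y₁ - gradient (fun y => H (x, y)) y₂‖ ≤ L₂ * ‖y₁ - y₂‖)
    (xs : X) (ys : Y) (hmin : ∀ p : X × Y, H (xs, ys) ≤ H p)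
    (x : X) (y : Y) (xp : X) (yp : Y)
    (hxp : ∀ x' : X, H (xp, y) ≤ H (x', y))
    (hyp : ∀ y' : Y, H (xp, yp) ≤ H (xp, y')) :
    H (xp, yp) - H (xs, ys) ≤ (1 - σ / L₁) * (1 - σ / L₂) * (H (x, y) - H (xs, ys)) := by
 

  have hd : Differentiable ℝ H := hC2.differentiable (by norm_num)
  have hs : H (xp, yp) - H (xs, ys) ≤
      (1 - σ / L₁) * (1 - σ / L₂) * (H (xp, y) - H (xs, ys)) := by
    have hp1 : 0 < L₁ := by linarith
    have hp2 : 0 < L₂ := by linarith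
    have ht : Filter.Tendsto (fun e : ℝ => (1 - σ / (L₁ + e)) * (1 - σ / (L₂ + e)) *
        (H (xp, y) - H (xs, ys))) (nhdsWithin 0 (Set.Ioi 0))
        (nhds ((1 - σ / (L₁ + 0)) * (1 - σ / (L₂ + 0)) * (H (xp, y) - H (xs, ys)))) := by
      apply Filter.Tendsto.mono_left _ nhdsWithin_le_nhds
      have : ContinuousAt (fun e : ℝ => (1 - σ / (L₁ + e)) * (1 - σ / (L₂ + e)) *
        (H (xp, y) - H (xs, ys))) 0 := by
        have n1 : L₁ + 0 ≠ 0 := by simpa using hp1.ne'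
        have n2 : L₂ + 0 ≠ 0 := by simpa using hp2.ne'
        fun_prop (disch := assumption)
      exact this
    rw [add_zero, add_zero] at ht
    refine ge_of_tendsto ht ?_
    filter_upwards [self_mem_nhdsWithin] with e he
    have he' : 0 < e := he
    refine aux_strict H σ (L₁ + e) (L₂ + e) hσ (by linarith) (by linarith) hd hsc ?_ ?_
      xs ys hmin y xp yp hxp hyp
    · intro b a₁ a₂
      refine (hgrad₁ b a₁ a₂).trans ?_
      gcongr
      linarith
    · intro a b₁ b₂
      refine (hgrad₂ a b₁ b₂).trans ?_
      gcongr
      linarith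
  refine hs.trans ?_
  have r1 : 0 ≤ 1 - σ / L₁ := by
    rw [sub_nonneg, div_le_one (by linarith)]; exact hL₁
  have r2 : 0 ≤ 1 - σ / L₂ := by
    rw [sub_nonneg, div_le_one (by linarith)]; exact hL₂
  exact mul_le_mul_of_nonneg_left (by linarith [hxp x]) (mul_nonneg r1 r2)
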